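/- Let d ≥ 1 and let B = (𝓑_1, …, 𝓑_{n+d}) be a collection of n+d finite nonempty subsets of ℤ^n, indexed by S = {1, …, n+d}, which itself is essential of defect −d, i.e., −d = d(B) = def(S) and def(J) > −d for every proper subset J ⊊ S. Then dim_ℝ L(S) = n and there exists a subset I ⊆ S with |I| = n such that the minimal defect of the subcollection (𝓑_i)_{i∈I} is 0. -/

import Mathlib

noncomputable section

/-- `L(J)`: the `ℝ`-linear span of all differences `a - b` with `a, b ∈ B i` for some `i ∈ J`. -/
def colSpan {ι V : Type*} [AddCommGroup V] [Module ℝ V]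
    (B : ι → Set V) (J : Set ι) : Submodule ℝ V :=
  Submodule.span ℝ {v | ∃ i ∈ J, ∃ a ∈ B i, ∃ b ∈ B i, v = a - b}

/-- The defect `def(J) = dim L(J) - |J|`. -/
def colDefect {ι V : Type*} [AddCommGroup V] [Module ℝ V]
    (B : ι → Set V) (J : Finset ι) : ℤ :=
  (Module.finrank ℝ (colSpan B (J : Set ι)) : ℤ) - (J.card : ℤ)

/-- The minimal defect `min_{J ⊆ S} def(J)` over all subsets of `S` (including `∅`). -/
def colMinDefectOn {ι V : Type*} [AddCommGroup V] [Module ℝ V]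
    (B : ι → Set V) (S : Finset ι) : ℤ :=
  S.powerset.inf' ⟨∅, Finset.empty_mem_powerset S⟩ (fun J => colDefect B J)

/-- A finite subset of `ℤ^n` viewed inside `ℝ^n`. -/
def realize {n : ℕ} (A : Finset (Fin n → ℤ)) : Set (Fin n → ℝ) :=
  (fun a : Fin n → ℤ => fun j => (a j : ℝ)) '' (A : Set (Fin n → ℤ))

section

variable {ι V : Type*} [AddCommGroup V] [Module ℝ V]

theorem colSpan_mono (B : ι → Set V) {J K : Set ι} (h : J ⊆ K) :
    colSpan B J ≤ colSpan B K :=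
  Submodule.span_mono fun _ ⟨i, hi, hv⟩ => ⟨i, h hi, hv⟩

theorem colSpan_union (B : ι → Set V) (J K : Set ι) :
    colSpan B (J ∪ K) = colSpan B J ⊔ colSpan B K := by
  refine le_antisymm (Submodule.span_le.2 ?_)
    (sup_le (colSpan_mono B Set.subset_union_left) (colSpan_mono B Set.subset_union_right))
  rintro v ⟨i, hi | hi, hv⟩
  · exact le_sup_left (a := colSpan B J) (Submodule.subset_span ⟨i, hi, hv⟩)
  · exact le_sup_right (a := colSpan B J) (Submodule.subset_span ⟨i, hi, hv⟩)

theorem colSpan_le_of_forall_singleton (B : ι → Set V) {J : Set ι} {W : Submodule ℝ V}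
    (h : ∀ i ∈ J, colSpan B {i} ≤ W) : colSpan B J ≤ W := by
  refine Submodule.span_le.2 ?_
  rintro v ⟨i, hi, hv⟩
  exact h i hi (Submodule.subset_span ⟨i, rfl, hv⟩)

theorem colDefect_empty (B : ι → Set V) : colDefect B ∅ = 0 := by
  have h : colSpan B ∅ = ⊥ := le_bot_iff.1 (colSpan_le_of_forall_singleton B (by simp))
  rw [colDefect, Finset.coe_empty, h, finrank_bot, Finset.card_empty, sub_self]

theorem colMinDefectOn_le (B : ι → Set V) {S J : Finset ι} (h : J ⊆ S) :
    colMinDefectOn B S ≤ colDefect B J :=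
  Finset.inf'_le _ (Finset.mem_powerset.2 h)

theorem colMinDefectOn_eq_zero (B : ι → Set V) {S : Finset ι}
    (h : ∀ J ⊆ S, 0 ≤ colDefect B J) : colMinDefectOn B S = 0 := by
  refine le_antisymm ?_ (Finset.le_inf' _ _ fun J hJ => h J (Finset.mem_powerset.1 hJ))
  exact (colMinDefectOn_le B (Finset.empty_subset S)).trans_eq (colDefect_empty B)

/-- The defect is submodular. -/
theorem colDefect_union_add_inter_le [FiniteDimensional ℝ V] [DecidableEq ι]
    (B : ι → Set V) (J K : Finset ι) :
    colDefect B (J ∪ K) + colDefect B (J ∩ K) ≤ colDefect B J + colDefect B K := by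
  have hdim := Submodule.finrank_sup_add_finrank_inf_eq
    (colSpan B (J : Set ι)) (colSpan B (K : Set ι))
  have hinter : Module.finrank ℝ (colSpan B ((J ∩ K : Finset ι) : Set ι)) ≤
      Module.finrank ℝ ↥(colSpan B (J : Set ι) ⊓ colSpan B (K : Set ι)) := by
    apply Submodule.finrank_mono
    rw [Finset.coe_inter]
    exact le_inf (colSpan_mono B Set.inter_subset_left) (colSpan_mono B Set.inter_subset_right)
  have hcard := Finset.card_union_add_card_inter J K
  simp only [colDefect]
  rw [Finset.coe_union, colSpan_union]
  omega

/-- If adjoining `x` to a set of nonnegative defect makes the defect negative, then the set has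
defect zero and its span already contains that of `B x`. -/
theorem colDefect_eq_zero_and_colSpan_singleton_le [FiniteDimensional ℝ V] [DecidableEq ι]
    (B : ι → Set V) {J : Finset ι} {x : ι} (hx : x ∉ J) (hJ : 0 ≤ colDefect B J)
    (hneg : colDefect B (insert x J) < 0) :
    colDefect B J = 0 ∧ colSpan B {x} ≤ colSpan B (J : Set ι) := by
  have hle : colSpan B (J : Set ι) ≤ colSpan B ((insert x J : Finset ι) : Set ι) :=
    colSpan_mono B (by simp)
  have hrank := Submodule.finrank_mono hle
  have hcard := Finset.card_insert_of_notMem hx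
  simp only [colDefect] at hJ hneg ⊢
  refine ⟨by omega, ?_⟩
  rw [Submodule.eq_of_le_of_finrank_eq hle (by omega)]
  exact colSpan_mono B (by simp)

/-- A finite collection all of whose defects are at least `-d` has a subcollection with
nonnegative defects that omits at most `d` members. -/
theorem exists_colDefect_nonneg_card_le [FiniteDimensional ℝ V] [Fintype ι]
    (B : ι → Set V) (d : ℕ) (h : ∀ J : Finset ι, -(d : ℤ) ≤ colDefect B J) :
    ∃ I : Finset ι, (∀ J ⊆ I, 0 ≤ colDefect B J) ∧ Fintype.card ι ≤ I.card + d := by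
  classical
  obtain ⟨I, hI⟩ := Set.Finite.exists_maximal
    (Set.toFinite {I : Finset ι | ∀ J ⊆ I, 0 ≤ colDefect B J})
    ⟨∅, fun J hJ => by rw [Finset.subset_empty.1 hJ, colDefect_empty]⟩
  obtain ⟨T, hT⟩ := Set.Finite.exists_maximal
    (Set.toFinite {T : Finset ι | T ⊆ I ∧ colDefect B T = 0})
    ⟨∅, Finset.empty_subset I, colDefect_empty B⟩
  have hind : ∀ J ⊆ I, 0 ≤ colDefect B J := hI.prop
  obtain ⟨hTI, hT0⟩ := hT.prop
  have hspan : ∀ x ∈ ((Iᶜ : Finset ι) : Set ι), colSpan B {x} ≤ colSpan B (T : Set ι) := by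
    intro x hx
    have hxI : x ∉ I := by simpa using hx
    have hnot : ¬ ∀ J ⊆ insert x I, 0 ≤ colDefect B J := fun hins =>
      hxI (hI.le_of_ge hins (Finset.subset_insert x I) (Finset.mem_insert_self x I))
    push Not at hnot
    obtain ⟨K, hK, hK0⟩ := hnot
    have hxK : x ∈ K := by
      by_contra hxK
      exact hK0.not_ge (hind K ((Finset.subset_insert_iff_of_notMem hxK).1 hK))
    have hKI : K.erase x ⊆ I := Finset.subset_insert_iff.1 hK
    obtain ⟨hzero, hle⟩ := colDefect_eq_zero_and_colSpan_singleton_le B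
      (Finset.notMem_erase x K) (hind _ hKI) (by rwa [Finset.insert_erase hxK])
    have hunion : T ∪ K.erase x ⊆ I := Finset.union_subset hTI hKI
    have hsub := colDefect_union_add_inter_le B T (K.erase x)
    have hnonneg := hind _ hunion
    have hnonneg' := hind _ (Finset.inter_subset_left.trans hTI : T ∩ K.erase x ⊆ I)
    have hKT : K.erase x ⊆ T := Finset.subset_union_right.trans
      (hT.le_of_ge ⟨hunion, by omega⟩ Finset.subset_union_left)
    exact hle.trans (colSpan_mono B (Finset.coe_subset.2 hKT))
  refine ⟨I, hind, ?_⟩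
  have hdefect := h (T ∪ Iᶜ)
  have hdisj : Disjoint T Iᶜ := disjoint_compl_right.mono_left hTI
  have hcard := Finset.card_add_card_compl I
  rw [colDefect, Finset.coe_union, colSpan_union,
    sup_eq_left.2 (colSpan_le_of_forall_singleton B hspan),
    Finset.card_union_of_disjoint hdisj] at hdefect
  rw [colDefect] at hT0
  omega

end

/-- If `B = (B_1, …, B_{n+d})` is essential of defect `−d` (with `d ≥ 1`),
then `dim L(S) = n` and there is a subset `I` of size `n` whose minimal defect is `0`. -/
theorem essential_exists_zero_defect_subcollection {n d : ℕ} (hn : 1 ≤ n) (hd : 1 ≤ d)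
    (B : Fin (n + d) → Finset (Fin n → ℤ)) (hB : ∀ i, (B i).Nonempty)
    (hmin : colMinDefectOn (fun i => realize (B i)) Finset.univ = -(d : ℤ))
    (hdef : colDefect (fun i => realize (B i)) Finset.univ = -(d : ℤ))
    (hess : ∀ J : Finset (Fin (n + d)), J ⊂ Finset.univ →
      -(d : ℤ) < colDefect (fun i => realize (B i)) J) :
    Module.finrank ℝ
      (colSpan (fun i => realize (B i)) ((Finset.univ : Finset (Fin (n + d))) : Set (Fin (n + d)))) = n ∧
    ∃ I : Finset (Fin (n + d)), I.card = n ∧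
      colMinDefectOn (fun i => realize (B i)) I = 0 := by
  constructor
  · rw [colDefect, Finset.card_univ, Fintype.card_fin] at hdef
    omega
  · obtain ⟨I, hI, hcard⟩ := exists_colDefect_nonneg_card_le (fun i => realize (B i)) d
      fun J => hmin.symm.le.trans (colMinDefectOn_le _ (Finset.subset_univ J))
    refine ⟨I, ?_, colMinDefectOn_eq_zero _ hI⟩
    have hnonneg := hI I Finset.Subset.rfl
    have hrank := Submodule.finrank_le (colSpan (fun i => realize (B i)) (I : Set (Fin (n + d))))
    rw [Module.finrank_fin_fun] at hrank
    rw [Fintype.card_fin] at hcard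
    rw [colDefect] at hnonneg
    omega
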